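/- Let H be a labelled graph on m ≥ 1 vertices and let d ≥ 1. Then there exists a ℚ-linear map T̄_H from the quotient module M_d/K_d to the quotient module M_{d+m−1}/K_{d+m−1} such that T̄_H(Y_G + K_d) = Y_{G+H} + K_{d+m−1} for every labelled graph G on d vertices. -/

import Mathlib

open scoped Classical
noncomputable section

/-- Words of length `d` in the positive integers. -/
abbrev NCWord (d : ℕ) := Fin d → ℕ+

/-- `M_d`: coefficient functions of homogeneous degree-`d` series in
noncommuting variables. -/
abbrev Md (d : ℕ) := NCWord d → ℚ

/-- `Y_G`, the chromatic symmetric function of a labelled graph in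
noncommuting variables, as an element of `M_d`. -/
def YG {d : ℕ} (G : SimpleGraph (Fin d)) : Md d :=
  fun w => if ∀ j k : Fin d, G.Adj j k → w j ≠ w k then 1 else 0

/-- Set partitions of `{0, …, d-1}`. -/
abbrev SetPtn (d : ℕ) := Finpartition (Finset.univ : Finset (Fin d))

/-- `j` and `k` lie in a common block of `π`. -/
def sameBlock {d : ℕ} (π : SetPtn d) (j k : Fin d) : Prop :=
  ∃ B ∈ π.parts, j ∈ B ∧ k ∈ B

/-- The elementary symmetric function `e_π` in noncommuting variables. -/
def eSP {d : ℕ} (π : SetPtn d) : Md d :=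
  fun w => if ∀ j k : Fin d, j ≠ k → sameBlock π j k → w j ≠ w k then 1 else 0

/-- The block of `π` containing `a`. -/
def blockOf {d : ℕ} (π : SetPtn d) (a : Fin d) : Finset (Fin d) :=
  Finset.univ.filter fun k => sameBlock π a k

/-- The type of a set partition relative to the distinguished element `a`:
the multiset of sizes of the blocks not containing `a` (an integer partition),
together with the size of the block containing `a`. -/
def ptype {d : ℕ} (π : SetPtn d) (a : Fin d) : Multiset ℕ × ℕ :=
  ((π.parts.erase (blockOf π a)).val.map Finset.card, (blockOf π a).card)

/-- `K_d`: the span of the differences `e_{π₁} - e_{π₂}` over pairs of set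
partitions of equal type (relative to the distinguished element `a`). -/
def Ksub {d : ℕ} (a : Fin d) : Submodule ℚ (Md d) :=
  Submodule.span ℚ
    {f | ∃ π₁ π₂ : SetPtn d, ptype π₁ a = ptype π₂ a ∧ f = eSP π₁ - eSP π₂}

/-- `(e)`-positivity of a labelled graph, with distinguished vertex `a`:
`Y_G` is congruent modulo `K_d` to a nonnegative combination of `e_π`'s. -/
def IsEPosNCAt {d : ℕ} (G : SimpleGraph (Fin d)) (a : Fin d) : Prop :=
  ∃ (s : Finset (SetPtn d)) (c : SetPtn d → ℚ),
    (∀ π, 0 ≤ c π) ∧ YG G - ∑ π ∈ s, c π • eSP π ∈ Ksub a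

/-- Induction `↑ : M_d → M_{d+1}`. -/
def induct {d : ℕ} (f : Md d) : Md (d + 1) :=
  fun w => if w (Fin.last d) = w ⟨d - 1, by omega⟩
    then f (fun t => w t.castSucc) else 0

/-- Concatenation of labelled graphs: identify the last vertex of `G` with
the first vertex of `H`. -/
def concatG {p q : ℕ} (G : SimpleGraph (Fin p)) (H : SimpleGraph (Fin q)) :
    SimpleGraph (Fin (p + q - 1)) :=
  SimpleGraph.fromRel fun a b =>
    (∃ i j : Fin p, G.Adj i j ∧ (a : ℕ) = (i : ℕ) ∧ (b : ℕ) = (j : ℕ)) ∨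
    (∃ i j : Fin q, H.Adj i j ∧ (a : ℕ) = (i : ℕ) + (p - 1) ∧ (b : ℕ) = (j : ℕ) + (p - 1))

/-- The reverse graph `G^r`. -/
def revG {d : ℕ} (G : SimpleGraph (Fin d)) : SimpleGraph (Fin d) :=
  SimpleGraph.comap (fun i : Fin d => (⟨d - 1 - (i : ℕ), by have := i.isLt; omega⟩ : Fin d)) G

/-- A labelled graph: a simple graph on vertex set `{0, …, n-1}`, `n ≥ 1`. -/
structure LGraph where
  n : ℕ
  npos : 0 < n
  G : SimpleGraph (Fin n)

/-- The last vertex of a labelled graph. -/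
def LGraph.last (A : LGraph) : Fin A.n := ⟨A.n - 1, by have := A.npos; omega⟩

/-- A labelled graph is `(e)`-positive (at its last vertex). -/
def LGraph.EPosNC (A : LGraph) : Prop := IsEPosNCAt A.G A.last

/-- Concatenation, as an operation on labelled graphs. -/
def LGraph.concat (A B : LGraph) : LGraph :=
  ⟨A.n + B.n - 1, by have := A.npos; have := B.npos; omega, concatG A.G B.G⟩

/-- Reversal, as an operation on labelled graphs. -/
def LGraph.rev (A : LGraph) : LGraph := ⟨A.n, A.npos, revG A.G⟩

/-- Appendable `(e)`-positivity: `G + H` is `(e)`-positive for every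
`(e)`-positive labelled graph `G`. -/
def LGraph.Appendable (H : LGraph) : Prop :=
  ∀ A : LGraph, A.EPosNC → (A.concat H).EPosNC

/-- The chromatic symmetric polynomial of `G` in `n` commuting variables. -/
def cspoly {V : Type} [Fintype V] [DecidableEq V] (G : SimpleGraph V) (n : ℕ) :
    MvPolynomial (Fin n) ℚ :=
  ∑ κ ∈ Finset.univ.filter (fun κ : V → Fin n => ∀ u v : V, G.Adj u v → κ u ≠ κ v),
    ∏ v : V, MvPolynomial.X (κ v)

/-- `e`-positivity of a finite graph. -/
def EPos {V : Type} [Fintype V] [DecidableEq V] (G : SimpleGraph V) : Prop :=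
  ∃ c : Nat.Partition (Fintype.card V) → ℚ, (∀ p, 0 ≤ c p) ∧
    ∀ n : ℕ, cspoly G n =
      ∑ p : Nat.Partition (Fintype.card V),
        c p • (p.parts.map fun r => MvPolynomial.esymm (Fin n) ℚ r).prod

/-- Closed neighbourhood of a vertex, as a finset. -/
def closedNbhd {d : ℕ} (G : SimpleGraph (Fin d)) (i : Fin d) : Finset (Fin d) :=
  Finset.univ.filter fun k => k = i ∨ G.Adj i k

/-- `m_i`: the largest label in the closed neighbourhood of `i`. -/
def mIdx {d : ℕ} (G : SimpleGraph (Fin d)) (i : Fin d) : Fin d :=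
  (closedNbhd G i).max' ⟨i, by simp [closedNbhd]⟩

/-- `w_i`: the smallest label in the closed neighbourhood of `i`. -/
def wIdx {d : ℕ} (G : SimpleGraph (Fin d)) (i : Fin d) : Fin d :=
  (closedNbhd G i).min' ⟨i, by simp [closedNbhd]⟩

/-- Labelled unit interval graph. -/
def IsUnitInterval {d : ℕ} (G : SimpleGraph (Fin d)) : Prop :=
  ∀ i v w j : Fin d, i ≤ v → v < w → w ≤ j → G.Adj i j → G.Adj v w

/-- An acyclic orientation of a graph, as an asymmetric relation with
irreflexive transitive closure whose symmetrization matches adjacency. -/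
def IsAcyclicOrientation {V : Type} (G : SimpleGraph V) (r : V → V → Prop) : Prop :=
  (∀ a b, r a b → ¬ r b a) ∧
  (∀ a b, a ≠ b → ((r a b ∨ r b a) ↔ G.Adj a b)) ∧
  Irreflexive (Relation.TransGen r)

/-- The set of sinks of an orientation. -/
def sinkSet {V : Type} [Fintype V] (r : V → V → Prop) : Finset V :=
  Finset.univ.filter fun x => ∀ y, ¬ r x y

/-- The labelled path `P_d`. -/
def PathG (d : ℕ) : SimpleGraph (Fin d) :=
  SimpleGraph.fromRel fun a b => (b : ℕ) = (a : ℕ) + 1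

/-- The labelled cycle `C_d`. -/
def CycleG (d : ℕ) : SimpleGraph (Fin d) :=
  SimpleGraph.fromRel fun a b => (b : ℕ) = (a : ℕ) + 1 ∨ ((a : ℕ) = 0 ∧ (b : ℕ) = d - 1)

lemma indicator_congr {P Q : Prop} {dP : Decidable P} {dQ : Decidable Q} (h : P ↔ Q) :
    @ite ℚ P dP 1 0 = @ite ℚ Q dQ 1 0 :=
  if_congr h rfl rfl

/-- The indicator of the words that are injective on the intersection of `S` with each fibre of
the labelling `f`. -/
def partialE {n : ℕ} (S : Finset (Fin n)) (f : Fin n → ℕ) : Md n :=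
  fun w => if ∀ i ∈ S, ∀ j ∈ S, i ≠ j → f i = f j → w i ≠ w j then 1 else 0

/-- The span of the functions `partialE S f` over all labellings `f`. -/
def spanE {n : ℕ} (S : Finset (Fin n)) : Submodule ℚ (Md n) :=
  Submodule.span ℚ (Set.range (partialE S))

/-- The indicator of the words taking the value `w a` throughout `A`. -/
def constOn {n : ℕ} (a : Fin n) (A : Finset (Fin n)) : Md n :=
  fun w => if ∀ i ∈ A, w i = w a then 1 else 0

/-- The indicator of the words that take the value `w a` throughout `A`, and that are injective
and avoid the value `w a` on `B`. -/
def hookOn {n : ℕ} (a : Fin n) (A B : Finset (Fin n)) : Md n :=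
  fun w => if (∀ i ∈ A, w i = w a) ∧ (∀ i ∈ B, ∀ j ∈ B, i ≠ j → w i ≠ w j) ∧
    (∀ b ∈ B, w b ≠ w a) then 1 else 0

/-- The indicator of the words that are constant on the intersection of `S` with each fibre of
the labelling `f`. -/
def partialP {n : ℕ} (S : Finset (Fin n)) (f : Fin n → ℕ) : Md n :=
  fun w => if ∀ i ∈ S, ∀ j ∈ S, f i = f j → w i = w j then 1 else 0

lemma partialE_mem_spanE {n : ℕ} (S : Finset (Fin n)) (f : Fin n → ℕ) :
    partialE S f ∈ spanE S :=
  Submodule.subset_span ⟨f, rfl⟩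

lemma mul_mem_spanE_union {n : ℕ} {S T : Finset (Fin n)} (h : Disjoint S T) {x y : Md n}
    (hx : x ∈ spanE S) (hy : y ∈ spanE T) : x * y ∈ spanE (S ∪ T) := by
  have hxy := Submodule.mul_mem_mul hx hy
  rw [spanE, spanE, Submodule.span_mul_span] at hxy
  refine Submodule.span_mono ?_ hxy
  rintro _ ⟨_, ⟨f, rfl⟩, _, ⟨g, rfl⟩, rfl⟩
  refine ⟨fun i => if i ∈ S then 2 * f i else 2 * g i + 1, ?_⟩
  have hST : ∀ i ∈ T, i ∉ S := fun i hi hS => Finset.disjoint_left.mp h hS hi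
  funext w
  simp only [partialE, Pi.mul_apply, mul_ite, mul_one, mul_zero, ← ite_and]
  refine indicator_congr ?_
  rw [and_comm]
  constructor
  · intro H
    refine ⟨fun i hi j hj hij hf => H i (by simp [hi]) j (by simp [hj]) hij ?_,
      fun i hi j hj hij hf => H i (by simp [hi]) j (by simp [hj]) hij ?_⟩ <;> grind
  · rintro ⟨H1, H2⟩ i hi j hj hij hf
    rw [Finset.mem_union] at hi hj
    have := hST i
    have := hST j
    by_cases hiS : i ∈ S <;> by_cases hjS : j ∈ S <;>
      simp only [hiS, hjS, if_true, if_false] at hf <;> grind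

lemma constOn_mul_partialE {n : ℕ} (a : Fin n) (A B : Finset (Fin n)) :
    constOn a A * partialE B (fun _ => 0) =
      hookOn a A B + ∑ b ∈ B, hookOn a (insert b A) (B.erase b) := by
  funext w
  simp only [Pi.mul_apply, Pi.add_apply, Finset.sum_apply]
  by_cases hA : ∀ i ∈ A, w i = w a
  swap
  · have h1 : constOn a A w = 0 := if_neg hA
    have h2 : hookOn a A B w = 0 := if_neg fun h => hA h.1
    rw [h1, h2, Finset.sum_eq_zero, zero_mul, zero_add]
    exact fun b _ => if_neg fun h => hA fun i hi => h.1 i (Finset.mem_insert_of_mem hi)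
  have h1 : constOn a A w = 1 := if_pos hA
  rw [h1, one_mul]
  by_cases hB : ∀ i ∈ B, ∀ j ∈ B, i ≠ j → w i ≠ w j
  swap
  · have h2 : partialE B (fun _ => 0) w = 0 := if_neg fun h => hB fun i hi j hj hij =>
      h i hi j hj hij rfl
    have h3 : hookOn a A B w = 0 := if_neg fun h => hB h.2.1
    rw [h2, h3, Finset.sum_eq_zero, zero_add]
    refine fun b _ => if_neg fun h => hB fun i hi j hj hij => ?_
    obtain ⟨ha, hb, hc⟩ := h
    have := ha b (Finset.mem_insert_self _ _)
    grind
  have h2 : partialE B (fun _ => 0) w = 1 := if_pos fun i hi j hj hij _ => hB i hi j hj hij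
  rw [h2]
  by_cases hc : ∀ b ∈ B, w b ≠ w a
  · have h3 : hookOn a A B w = 1 := if_pos ⟨hA, hB, hc⟩
    rw [h3, Finset.sum_eq_zero, add_zero]
    exact fun b hb => if_neg fun h => hc b hb (h.1 b (Finset.mem_insert_self _ _))
  · have h3 : hookOn a A B w = 0 := if_neg fun h => hc h.2.2
    push Not at hc
    obtain ⟨b, hb, hba⟩ := hc
    rw [h3, zero_add, Finset.sum_eq_single_of_mem b hb]
    · refine (if_pos ⟨?_, ?_, ?_⟩).symm <;> grind
    · exact fun c hc hcb => if_neg fun h => hB c hc b hb hcb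
        ((h.1 c (Finset.mem_insert_self _ _)).trans hba.symm)

lemma hookOn_sub_mem_spanE {n : ℕ} (a : Fin n) (N : ℕ)
    (ih : ∀ A : Finset (Fin n), A.card < N → a ∉ A → constOn a A ∈ spanE (insert a A))
    (k : ℕ) : ∀ A B : Finset (Fin n), B.card = k → Disjoint A B → a ∉ A → a ∉ B →
      A.card + k ≤ N →
      hookOn a A B - ((-1 : ℚ) ^ k * (k.factorial : ℚ)) • constOn a (A ∪ B) ∈
        spanE (insert a (A ∪ B)) := by
  induction k with
  | zero =>
    intro A B hB _ _ _ _
    obtain rfl := Finset.card_eq_zero.mp hB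
    have : hookOn a A ∅ = constOn a A := by
      funext w
      simp [hookOn, constOn]
    simp [this]
  | succ k hk =>
    intro A B hB hAB haA haB hN
    have key := constOn_mul_partialE a A B
    have hprod : constOn a A * partialE B (fun _ => 0) ∈ spanE (insert a (A ∪ B)) := by
      rw [← Finset.insert_union]
      refine mul_mem_spanE_union ?_ (ih A (by omega) haA) (partialE_mem_spanE _ _)
      rw [Finset.disjoint_insert_left]
      exact ⟨haB, hAB⟩
    have hsum : ∑ b ∈ B, (hookOn a (insert b A) (B.erase b) -
        ((-1 : ℚ) ^ k * (k.factorial : ℚ)) • constOn a (A ∪ B)) ∈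
          spanE (insert a (A ∪ B)) := by
      refine Submodule.sum_mem _ fun b hb => ?_
      have hun : insert b A ∪ B.erase b = A ∪ B := by grind
      have hbA : b ∉ A := fun h => Finset.disjoint_left.mp hAB h hb
      have := hk (insert b A) (B.erase b) (by rw [Finset.card_erase_of_mem hb]; omega)
        (by rw [Finset.disjoint_left] at hAB ⊢; grind) (by grind) (by grind)
        (by rw [Finset.card_insert_of_notMem hbA]; omega)
      rwa [hun] at this
    rw [Finset.sum_sub_distrib, Finset.sum_const, hB] at hsum
    have := Submodule.sub_mem _ hprod hsum
    convert this using 1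
    rw [key, Nat.factorial_succ, ← Nat.cast_smul_eq_nsmul ℚ, smul_smul]
    push_cast
    rw [show (-1 : ℚ) ^ (k + 1) * (((k : ℚ) + 1) * (k.factorial : ℚ)) =
      -(((k : ℚ) + 1) * ((-1) ^ k * (k.factorial : ℚ))) by ring, neg_smul]
    abel

lemma constOn_mem_spanE {n : ℕ} (a : Fin n) (A : Finset (Fin n)) (ha : a ∉ A) :
    constOn a A ∈ spanE (insert a A) := by
  induction hN : A.card using Nat.strong_induction_on generalizing A with
  | _ N ih =>
    have h := hookOn_sub_mem_spanE a N (fun B hB haB => ih _ hB B haB rfl) N ∅ A hN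
      (Finset.disjoint_empty_left _) (Finset.notMem_empty _) ha (by simp)
    rw [Finset.empty_union] at h
    have hhook : hookOn a ∅ A = partialE (insert a A) (fun _ => 0) := by
      funext w
      refine if_congr ?_ rfl rfl
      constructor
      · rintro ⟨-, h1, h2⟩ i hi j hj hij -
        grind
      · intro H
        refine ⟨by simp, fun i hi j hj hij => H i (by simp [hi]) j (by simp [hj]) hij rfl,
          fun b hb => H b (by simp [hb]) a (by simp) (by grind) rfl⟩
    rw [hhook] at h
    have h' := Submodule.sub_mem _ (partialE_mem_spanE (insert a A) fun _ => 0) h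
    rw [sub_sub_cancel] at h'
    exact (Submodule.smul_mem_iff _ (mul_ne_zero (pow_ne_zero _ (by norm_num))
      (Nat.cast_ne_zero.mpr N.factorial_ne_zero))).mp h'

lemma partialP_filter_mem_spanE {n : ℕ} (f : Fin n → ℕ) (C : Finset ℕ) :
    partialP (Finset.univ.filter fun i => f i ∈ C) f ∈
      spanE (Finset.univ.filter fun i => f i ∈ C) := by
  induction C using Finset.induction_on with
  | empty =>
    have : partialP (Finset.univ.filter fun i => f i ∈ (∅ : Finset ℕ)) f =
        partialE (Finset.univ.filter fun i => f i ∈ (∅ : Finset ℕ)) f := by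
      funext w
      simp [partialP, partialE]
    rw [this]
    exact partialE_mem_spanE _ _
  | insert c C hc ih =>
    by_cases hf : ∃ a, f a = c
    · obtain ⟨a, ha⟩ := hf
      set S := Finset.univ.filter fun i => f i ∈ C with hS
      set A := (Finset.univ.filter fun i => f i = c).erase a with hA
      have hun : (Finset.univ.filter fun i => f i ∈ insert c C) = S ∪ insert a A := by
        ext i
        simp only [hS, hA, Finset.mem_filter, Finset.mem_univ, true_and, Finset.mem_insert,
          Finset.mem_union, Finset.mem_erase]
        grind
      have hdis : Disjoint S (insert a A) := by
        rw [Finset.disjoint_left]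
        simp only [hS, hA, Finset.mem_filter, Finset.mem_univ, true_and, Finset.mem_insert,
          Finset.mem_erase]
        grind
      have hP : partialP (S ∪ insert a A) f = partialP S f * constOn a A := by
        funext w
        simp only [partialP, constOn, Pi.mul_apply, mul_ite, mul_one, mul_zero, ← ite_and]
        refine if_congr ?_ rfl rfl
        simp only [hS, hA, Finset.mem_filter, Finset.mem_univ, true_and, Finset.mem_insert,
          Finset.mem_union, Finset.mem_erase]
        constructor
        · intro H
          exact ⟨fun i hi => H i (by grind) a (by grind) (by grind),
            fun i hi j hj hij => H i (by grind) j (by grind) hij⟩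
        · rintro ⟨H1, H2⟩ i hi j hj hij
          by_cases hic : f i = c
          · have hwi : w i = w a := by grind
            have hwj : w j = w a := by grind
            rw [hwi, hwj]
          · exact H2 i (by grind) j (by grind) hij
      rw [hun, hP]
      exact mul_mem_spanE_union hdis ih (constOn_mem_spanE a A (by simp [hA]))
    · have : (Finset.univ.filter fun i => f i ∈ insert c C) =
          Finset.univ.filter fun i => f i ∈ C := by
        ext i
        have : f i ≠ c := fun h => hf ⟨i, h⟩
        simp [this]
      rw [this]
      exact ih

lemma partialP_univ_mem_spanE {n : ℕ} (f : Fin n → ℕ) :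
    partialP Finset.univ f ∈ spanE (Finset.univ : Finset (Fin n)) := by
  have h := partialP_filter_mem_spanE f (Finset.univ.image f)
  simpa using h

lemma prod_mul_partialP_mem_spanE {n : ℕ} (D : Finset (Fin n × Fin n)) (f : Fin n → ℕ) :
    (fun w : NCWord n => (∏ e ∈ D, if w e.1 = w e.2 then (0 : ℚ) else 1) *
      partialP Finset.univ f w) ∈ spanE (Finset.univ : Finset (Fin n)) := by
  induction D using Finset.induction_on generalizing f with
  | empty => simpa using partialP_univ_mem_spanE f
  | insert e D he ih =>
    have := Submodule.sub_mem _ (ih f) (ih fun x => if f x = f e.2 then f e.1 else f x)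
    convert this using 1
    funext w
    rw [Finset.prod_insert he, Pi.sub_apply]
    have hP : partialP Finset.univ (fun x => if f x = f e.2 then f e.1 else f x) w =
        if w e.1 = w e.2 then partialP Finset.univ f w else 0 := by
      simp only [partialP, ← ite_and]
      refine if_congr ?_ rfl rfl
      simp only [Finset.mem_univ, true_implies]
      constructor
      · intro H
        exact ⟨H _ _ (by grind), fun i j hij => H _ _ (by simp [hij])⟩
      · rintro ⟨h, H⟩ i j hij
        have := H i j
        have := H i e.1
        have := H i e.2
        have := H j e.1
        have := H j e.2
        grind
    rw [hP]
    split_ifs <;> ring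

lemma YG_mem_spanE {n : ℕ} (G : SimpleGraph (Fin n)) :
    YG G ∈ spanE (Finset.univ : Finset (Fin n)) := by
  have := prod_mul_partialP_mem_spanE (Finset.univ.filter fun e : Fin n × Fin n => G.Adj e.1 e.2)
    Fin.val
  convert this using 1
  funext w
  have hP : partialP Finset.univ (Fin.val : Fin n → ℕ) w = 1 :=
    if_pos fun i _ j _ hij => congrArg w (Fin.ext hij)
  rw [hP, mul_one, YG]
  split_ifs with h
  · refine (Finset.prod_eq_one fun e he => if_neg ?_).symm
    exact h _ _ (Finset.mem_filter.mp he).2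
  · push Not at h
    obtain ⟨j, k, hjk, hw⟩ := h
    symm
    exact Finset.prod_eq_zero (Finset.mem_filter.mpr ⟨Finset.mem_univ (j, k), hjk⟩) (if_pos hw)

lemma sameBlock_iff_part_eq {n : ℕ} (π : SetPtn n) (i j : Fin n) :
    sameBlock π i j ↔ π.part i = π.part j := by
  constructor
  · rintro ⟨B, hB, hi, hj⟩
    rw [π.part_eq_of_mem hB hi, π.part_eq_of_mem hB hj]
  · intro h
    exact ⟨π.part i, π.part_mem.mpr (Finset.mem_univ _), π.mem_part (Finset.mem_univ _),
      h ▸ π.mem_part (Finset.mem_univ _)⟩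

lemma blockOf_eq_part {n : ℕ} (π : SetPtn n) (a : Fin n) : blockOf π a = π.part a := by
  ext k
  rw [blockOf, Finset.mem_filter, sameBlock_iff_part_eq]
  simp only [Finset.mem_univ, true_and]
  constructor
  · intro h
    exact h ▸ π.mem_part (Finset.mem_univ _)
  · intro h
    exact (π.part_eq_of_mem (π.part_mem.mpr (Finset.mem_univ _)) h).symm

lemma YG_mem_span_eSP {n : ℕ} (G : SimpleGraph (Fin n)) :
    YG G ∈ Submodule.span ℚ (Set.range (eSP : SetPtn n → Md n)) := by
  refine Submodule.span_mono ?_ (YG_mem_spanE G)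
  rintro _ ⟨f, rfl⟩
  refine ⟨Finpartition.ofSetoid (Setoid.ker f), ?_⟩
  have h : ∀ i j, sameBlock (Finpartition.ofSetoid (Setoid.ker f)) i j ↔ f i = f j := by
    intro i j
    have : j ∈ (Finpartition.ofSetoid (Setoid.ker f)).part i ↔ f i = f j :=
      Finpartition.mem_part_ofSetoid_iff_rel
    rw [← this, ← blockOf_eq_part, blockOf, Finset.mem_filter]
    simp
  funext w
  simp only [eSP, partialE, h, Finset.mem_univ, true_implies]

lemma eSP_eq_YG {n : ℕ} (π : SetPtn n) : eSP π = YG (SimpleGraph.fromRel (sameBlock π)) := by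
  funext w
  refine indicator_congr ?_
  simp only [SimpleGraph.fromRel_adj, sameBlock_iff_part_eq]
  grind

/-- The image of a set partition under a permutation of the ground set. -/
def permSP {n : ℕ} (σ : Equiv.Perm (Fin n)) (π : SetPtn n) : SetPtn n :=
  Finpartition.ofExistsUnique (π.parts.map (Finset.mapEmbedding σ.toEmbedding).toEmbedding)
    (fun _ _ => Finset.subset_univ _)
    (by
      intro a _
      obtain ⟨t, ⟨ht, hat⟩, huniq⟩ := π.existsUnique_mem (Finset.mem_univ (σ.symm a))
      refine ⟨t.map σ.toEmbedding, ⟨Finset.mem_map.mpr ⟨t, ht, rfl⟩, ?_⟩, ?_⟩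
      · exact Finset.mem_map.mpr ⟨_, hat, by simp⟩
      · rintro _ ⟨hu, hau⟩
        obtain ⟨u, hu', rfl⟩ := Finset.mem_map.mp hu
        obtain ⟨x, hx, rfl⟩ := Finset.mem_map.mp hau
        have := huniq u ⟨hu', by simpa using hx⟩
        subst this
        rfl)
    (by
      intro h
      obtain ⟨t, ht, h0⟩ := Finset.mem_map.mp h
      have : t = ∅ := Finset.map_eq_empty.mp h0
      subst this
      exact π.bot_notMem ht)

lemma permSP_parts {n : ℕ} (σ : Equiv.Perm (Fin n)) (π : SetPtn n) :
    (permSP σ π).parts = π.parts.map (Finset.mapEmbedding σ.toEmbedding).toEmbedding :=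
  rfl

lemma sameBlock_permSP {n : ℕ} (σ : Equiv.Perm (Fin n)) (π : SetPtn n) (i j : Fin n) :
    sameBlock (permSP σ π) (σ i) (σ j) ↔ sameBlock π i j := by
  constructor
  · rintro ⟨B, hB, hi, hj⟩
    rw [permSP_parts] at hB
    obtain ⟨t, ht, rfl⟩ := Finset.mem_map.mp hB
    exact ⟨t, ht, by simpa using hi, by simpa using hj⟩
  · rintro ⟨B, hB, hi, hj⟩
    exact ⟨B.map σ.toEmbedding, Finset.mem_map.mpr ⟨B, hB, rfl⟩, by simpa using hi,
      by simpa using hj⟩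

lemma eSP_comp_perm {n : ℕ} (σ : Equiv.Perm (Fin n)) {π π' : SetPtn n}
    (h : ∀ i j, sameBlock π' (σ i) (σ j) ↔ sameBlock π i j) (w : NCWord n) :
    eSP π (w ∘ σ) = eSP π' w := by
  refine if_congr ?_ rfl rfl
  constructor
  · intro H j k hjk hs
    have := H (σ.symm j) (σ.symm k) (by simpa using hjk) ((h _ _).mp (by simpa using hs))
    simpa using this
  · intro H j k hjk hs
    exact H _ _ (by simpa using hjk) ((h _ _).mpr hs)

lemma ptype_permSP {n : ℕ} (σ : Equiv.Perm (Fin n)) (π : SetPtn n) {a : Fin n}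
    (ha : σ a = a) : ptype (permSP σ π) a = ptype π a := by
  have hb : blockOf (permSP σ π) a =
      (Finset.mapEmbedding σ.toEmbedding).toEmbedding (blockOf π a) := by
    ext k
    obtain ⟨k, rfl⟩ := σ.surjective k
    have := sameBlock_permSP σ π a k
    rw [ha] at this
    simp [blockOf, this]
  rw [ptype, ptype, hb, permSP_parts, ← Finset.map_erase, Finset.map_val, Multiset.map_map]
  exact congrArg₂ Prod.mk (Multiset.map_congr rfl fun t _ => Finset.card_map σ.toEmbedding)
    (Finset.card_map σ.toEmbedding)

lemma sub_comp_perm_mem_Ksub {n : ℕ} (σ : Equiv.Perm (Fin n)) {a : Fin n} (ha : σ a = a)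
    {F : Md n} (hF : F ∈ Submodule.span ℚ (Set.range (eSP : SetPtn n → Md n))) :
    F - (fun w => F (w ∘ σ)) ∈ Ksub a := by
  let L : Md n →ₗ[ℚ] Md n := LinearMap.id - LinearMap.funLeft ℚ ℚ (fun w : NCWord n => w ∘ σ)
  have hle : Submodule.span ℚ (Set.range (eSP : SetPtn n → Md n)) ≤ (Ksub a).comap L := by
    rw [Submodule.span_le]
    rintro _ ⟨π, rfl⟩
    refine Submodule.subset_span ⟨π, permSP σ π, (ptype_permSP σ π ha).symm, ?_⟩
    funext w
    simp only [L, LinearMap.sub_apply, LinearMap.id_apply, Pi.sub_apply, LinearMap.funLeft_apply]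
    rw [eSP_comp_perm σ (sameBlock_permSP σ π)]
  exact hle hF

lemma exists_equiv_of_card_fiber_eq {α β γ : Type*} [Finite α] [Finite β]
    (f : α → γ) (g : β → γ)
    (h : ∀ c, Nat.card {x // f x = c} = Nat.card {y // g y = c}) :
    ∃ e : α ≃ β, ∀ x, g (e x) = f x :=
  ⟨Equiv.ofFiberEquiv fun c => (Finite.card_eq.mp (h c)).some,
    fun x => Equiv.ofFiberEquiv_map _ x⟩

lemma exists_equiv_of_map_val_eq {α β γ : Type*} (s : Finset α) (t : Finset β)
    (f : α → γ) (g : β → γ) (h : s.val.map f = t.val.map g) :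
    ∃ e : s ≃ t, ∀ x, g (e x) = f x := by
  refine exists_equiv_of_card_fiber_eq (fun x : s => f x) (fun y : t => g y) fun c => ?_
  have hc := congrArg (Multiset.count c) h
  rw [Multiset.count_map, Multiset.count_map] at hc
  rw [Nat.card_congr (Equiv.subtypeSubtypeEquivSubtypeInter (· ∈ s) (f · = c)),
    Nat.card_congr (Equiv.subtypeSubtypeEquivSubtypeInter (· ∈ t) (g · = c)),
    Nat.subtype_card (s.filter fun x => c = f x) (by simp [eq_comm]),
    Nat.subtype_card (t.filter fun y => c = g y) (by simp [eq_comm])]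
  exact hc

lemma exists_perm_of_ptype_eq {n : ℕ} {π₁ π₂ : SetPtn n} {a : Fin n}
    (h : ptype π₁ a = ptype π₂ a) :
    ∃ σ : Equiv.Perm (Fin n), σ a = a ∧
      ∀ i j, sameBlock π₂ (σ i) (σ j) ↔ sameBlock π₁ i j := by
  simp only [ptype, blockOf_eq_part, Prod.mk.injEq] at h
  obtain ⟨h1, h2⟩ := h
  have hmem : ∀ (π : SetPtn n) i, π.part i ∈ π.parts := fun π i =>
    π.part_mem.mpr (Finset.mem_univ _)
  have hkey : ∀ π : SetPtn n, π.parts.val.map (fun B => if B = π.part a then 0 else B.card) =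
      0 ::ₘ (π.parts.erase (π.part a)).val.map Finset.card := by
    intro π
    conv_lhs => rw [← Finset.insert_erase (hmem π a)]
    rw [Finset.insert_val_of_notMem (Finset.notMem_erase _ _), Multiset.map_cons, if_pos rfl]
    congr 1
    exact Multiset.map_congr rfl fun B hB => if_neg (Finset.ne_of_mem_erase hB)
  obtain ⟨φ, hφ⟩ := exists_equiv_of_map_val_eq π₁.parts π₂.parts _ _
    ((hkey π₁).trans (by rw [h1]; exact (hkey π₂).symm))
  have hpos : ∀ (π : SetPtn n) (B : π.parts), B.1.card ≠ 0 := fun π B =>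
    Finset.card_ne_zero.mpr (π.nonempty_of_mem_parts B.2)
  have hφa : ∀ B : π₁.parts, (φ B).1 = π₂.part a ↔ B.1 = π₁.part a := by
    intro B
    have := hφ B
    have := hpos _ B
    have := hpos _ (φ B)
    grind
  have hφcard : ∀ B : π₁.parts, (φ B).1.card = B.1.card := by
    intro B
    have := hφ B
    have := hφa B
    grind
  have hpart : ∀ (π : SetPtn n) (B : π.parts),
      Nat.card {i // (⟨π.part i, hmem π i⟩ : π.parts) = B} = B.1.card := by
    intro π B
    refine Nat.subtype_card B.1 fun i => ?_
    rw [Subtype.ext_iff]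
    exact ⟨fun h => π.part_eq_of_mem B.2 h, fun h => h ▸ π.mem_part (Finset.mem_univ _)⟩
  obtain ⟨τ, hτ⟩ := exists_equiv_of_card_fiber_eq
    (fun i => φ ⟨π₁.part i, hmem π₁ i⟩) (fun i => (⟨π₂.part i, hmem π₂ i⟩ : π₂.parts)) (by
      intro B
      rw [hpart π₂ B]
      obtain ⟨B, rfl⟩ := φ.surjective B
      simp only [φ.injective.eq_iff]
      rw [hpart π₁ B, hφcard])
  have hτa : π₂.part (τ a) = π₂.part a := by
    have := congrArg Subtype.val (hτ a)
    rw [(hφa _).mpr rfl] at this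
    exact this
  have hswap : ∀ i, π₂.part (Equiv.swap (τ a) a i) = π₂.part i := by
    intro i
    rw [Equiv.swap_apply_def]
    split_ifs with h1 h2
    · rw [h1, hτa]
    · rw [h2, hτa]
    · rfl
  refine ⟨τ.trans (Equiv.swap (τ a) a), by simp, fun i j => ?_⟩
  rw [sameBlock_iff_part_eq, sameBlock_iff_part_eq, Equiv.trans_apply, Equiv.trans_apply,
    hswap, hswap]
  have hi := congrArg Subtype.val (hτ i)
  have hj := congrArg Subtype.val (hτ j)
  simp only at hi hj
  rw [hi, hj, Subtype.coe_inj, φ.injective.eq_iff, Subtype.mk.injEq]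

/-- The inclusion of the vertices of the first graph into those of a concatenation. -/
def concatInl (d m : ℕ) (hm : 0 < m) (i : Fin d) : Fin (d + m - 1) :=
  ⟨i, by omega⟩

/-- The inclusion of the vertices of the second graph into those of a concatenation. -/
def concatInr (d m : ℕ) (hd : 0 < d) (j : Fin m) : Fin (d + m - 1) :=
  ⟨j + (d - 1), by omega⟩

/-- Multiplication by `Y_H` on the last `m` letters, overlapping in one letter. -/
def concatMap {m : ℕ} (H : SimpleGraph (Fin m)) (d : ℕ) (hd : 0 < d) (hm : 0 < m) :
    Md d →ₗ[ℚ] Md (d + m - 1) where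
  toFun f w := f (w ∘ concatInl d m hm) * YG H (w ∘ concatInr d m hd)
  map_add' f g := by
    funext w
    exact add_mul _ _ _
  map_smul' c f := by
    funext w
    exact mul_assoc _ _ _

lemma concatMap_YG {m : ℕ} (H : SimpleGraph (Fin m)) (d : ℕ) (hd : 0 < d) (hm : 0 < m)
    (G : SimpleGraph (Fin d)) : concatMap H d hd hm (YG G) = YG (concatG G H) := by
  funext w
  change YG G (w ∘ concatInl d m hm) * YG H (w ∘ concatInr d m hd) = _
  simp only [YG, mul_ite, mul_one, mul_zero, ← ite_and]
  refine indicator_congr ?_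
  constructor
  · rintro ⟨h2, h1⟩ j k hjk
    rw [concatG, SimpleGraph.fromRel_adj] at hjk
    have key : ∀ j k : Fin (d + m - 1),
        ((∃ i i' : Fin d, G.Adj i i' ∧ (j : ℕ) = (i : ℕ) ∧ (k : ℕ) = (i' : ℕ)) ∨
        (∃ i i' : Fin m, H.Adj i i' ∧ (j : ℕ) = (i : ℕ) + (d - 1) ∧
          (k : ℕ) = (i' : ℕ) + (d - 1))) → w j ≠ w k := by
      rintro j k (⟨i, i', hi, hj, hk⟩ | ⟨i, i', hi, hj, hk⟩)
      · obtain rfl : j = concatInl d m hm i := Fin.ext hj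
        obtain rfl : k = concatInl d m hm i' := Fin.ext hk
        exact h1 i i' hi
      · obtain rfl : j = concatInr d m hd i := Fin.ext hj
        obtain rfl : k = concatInr d m hd i' := Fin.ext hk
        exact h2 i i' hi
    rcases hjk.2 with h | h
    · exact key j k h
    · exact (key k j h).symm
  · intro h
    constructor
    · intro i j hij
      refine h _ _ ?_
      rw [concatG, SimpleGraph.fromRel_adj]
      refine ⟨fun he => hij.ne (Fin.ext ?_), Or.inl (Or.inr ⟨i, j, hij, rfl, rfl⟩)⟩
      have := congrArg Fin.val he
      simp only [concatInr] at this
      omega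
    · intro i j hij
      refine h _ _ ?_
      rw [concatG, SimpleGraph.fromRel_adj]
      refine ⟨fun he => hij.ne (Fin.ext ?_), Or.inl (Or.inl ⟨i, j, hij, rfl, rfl⟩)⟩
      exact Fin.mk.inj_iff.mp he

lemma concatMap_eSP_sub_mem_Ksub {m : ℕ} (H : SimpleGraph (Fin m)) (d : ℕ) (hd : 0 < d)
    (hm : 0 < m) {π₁ π₂ : SetPtn d}
    (h : ptype π₁ (⟨d - 1, by omega⟩ : Fin d) = ptype π₂ (⟨d - 1, by omega⟩ : Fin d)) :
    concatMap H d hd hm (eSP π₁ - eSP π₂) ∈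
      Ksub (⟨d + m - 2, by omega⟩ : Fin (d + m - 1)) := by
  obtain ⟨σ, hσ, hπ⟩ := exists_perm_of_ptype_eq h
  let ι : Fin d ↪ Fin (d + m - 1) :=
    ⟨concatInl d m hm, fun i j hij => Fin.ext (Fin.mk.inj_iff.mp hij)⟩
  let τ : Equiv.Perm (Fin (d + m - 1)) := σ.viaFintypeEmbedding ι
  have hinl : ∀ i, τ (concatInl d m hm i) = concatInl d m hm (σ i) := fun i =>
    σ.viaFintypeEmbedding_apply_image ι i
  have hinr : ∀ j, τ (concatInr d m hd j) = concatInr d m hd j := by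
    intro j
    by_cases hj : (j : ℕ) = 0
    · have : concatInr d m hd j = concatInl d m hm ⟨d - 1, by omega⟩ :=
        Fin.ext (by simp [concatInr, concatInl, hj])
      rw [this, hinl, hσ]
    · refine σ.viaFintypeEmbedding_apply_notMem_range ι ?_
      rintro ⟨i, hi⟩
      have : (i : ℕ) = j + (d - 1) := Fin.mk.inj_iff.mp hi
      omega
  have hlast : τ ⟨d + m - 2, by omega⟩ = ⟨d + m - 2, by omega⟩ := by
    have : (⟨d + m - 2, by omega⟩ : Fin (d + m - 1)) = concatInr d m hd ⟨m - 1, by omega⟩ :=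
      Fin.ext (by simp only [concatInr]; omega)
    rw [this, hinr]
  have hF : concatMap H d hd hm (eSP π₁) ∈
      Submodule.span ℚ (Set.range (eSP : SetPtn (d + m - 1) → Md (d + m - 1))) := by
    rw [eSP_eq_YG, concatMap_YG]
    exact YG_mem_span_eSP _
  convert sub_comp_perm_mem_Ksub τ hlast hF using 1
  rw [map_sub]
  congr 1
  funext w
  change eSP π₂ (w ∘ concatInl d m hm) * YG H (w ∘ concatInr d m hd) =
    eSP π₁ ((w ∘ τ) ∘ concatInl d m hm) * YG H ((w ∘ τ) ∘ concatInr d m hd)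
  have hl : (w ∘ τ) ∘ concatInl d m hm = (w ∘ concatInl d m hm) ∘ σ :=
    funext fun i => congrArg w (hinl i)
  have hr : (w ∘ τ) ∘ concatInr d m hd = w ∘ concatInr d m hd :=
    funext fun j => congrArg w (hinr j)
  rw [hl, hr, eSP_comp_perm σ hπ]

theorem stmt10 (H : LGraph) (d : ℕ) (hd : 0 < d) :
    ∃ T : (Md d ⧸ Ksub (⟨d - 1, by omega⟩ : Fin d)) →ₗ[ℚ]
        (Md (d + H.n - 1) ⧸
          Ksub (⟨d + H.n - 2, by have := H.npos; omega⟩ : Fin (d + H.n - 1))),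
      ∀ G : SimpleGraph (Fin d),
        T (Submodule.Quotient.mk (YG G)) =
          Submodule.Quotient.mk (YG (concatG G H.G)) := by
  refine ⟨Submodule.mapQ _ _ (concatMap H.G d hd H.npos) ?_, fun G => ?_⟩
  · rw [Ksub, Submodule.span_le]
    rintro _ ⟨π₁, π₂, h, rfl⟩
    exact concatMap_eSP_sub_mem_Ksub H.G d hd H.npos h
  · rw [← concatMap_YG H.G d hd H.npos G]
    rfl
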